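/- For every 2-player stage game G with |V₁^{p,p}| = 1 and |V₂^{p,p}| > 1: if G ∉ 𝒢_LS^{p,p} (local suboptimality can never occur in any SPE of any G(T) when both players use only pure strategies), then G ∉ 𝒢_LS^{m,p} (local suboptimality can never occur in any SPE of any G(T) when player 1 may use mixed strategies and player 2 only pure strategies). -/

import Mathlib

open Finset

/-- A mixed strategy on a finite action set: a probability distribution. -/
structure Mix (A : Type*) [Fintype A] where
  p : A → ℝ
  nonneg : ∀ a, 0 ≤ p a
  sum_one : ∑ a, p a = 1

namespace Mix

/-- The Dirac (pure) mixed strategy at an action. -/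
def pure {A : Type*} [Fintype A] [DecidableEq A] (a : A) : Mix A where
  p := fun b => if b = a then 1 else 0
  nonneg := by intro b; by_cases hb : b = a <;> simp [hb]
  sum_one := by simp

/-- The support of a mixed strategy. -/
def support {A : Type*} [Fintype A] (σ : Mix A) : Set A := {a | 0 < σ.p a}

end Mix

section TwoPlayer

variable {A₁ A₂ : Type*} [Fintype A₁] [Fintype A₂] [DecidableEq A₁] [DecidableEq A₂]

/-- Expected payoff under a mixed strategy profile. -/
def expPay (u : A₁ → A₂ → ℝ) (σ₁ : Mix A₁) (σ₂ : Mix A₂) : ℝ :=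
  ∑ a₁, ∑ a₂, σ₁.p a₁ * σ₂.p a₂ * u a₁ a₂

/-- Player 1's pure action `a₁` is a best response among pure strategies to `a₂`. -/
def BR1p (u₁ : A₁ → A₂ → ℝ) (a₁ : A₁) (a₂ : A₂) : Prop := ∀ b₁, u₁ b₁ a₂ ≤ u₁ a₁ a₂

/-- Player 2's pure action `a₂` is a best response among pure strategies to `a₁`. -/
def BR2p (u₂ : A₁ → A₂ → ℝ) (a₁ : A₁) (a₂ : A₂) : Prop := ∀ b₂, u₂ a₁ b₂ ≤ u₂ a₁ a₂

/-- Player 1's mixed strategy `σ₁` is a best response (among mixed strategies) to `σ₂`. -/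
def BR1m (u₁ : A₁ → A₂ → ℝ) (σ₁ : Mix A₁) (σ₂ : Mix A₂) : Prop :=
  ∀ τ₁ : Mix A₁, expPay u₁ τ₁ σ₂ ≤ expPay u₁ σ₁ σ₂

/-- Player 2's mixed strategy `σ₂` is a best response (among mixed strategies) to `σ₁`. -/
def BR2m (u₂ : A₁ → A₂ → ℝ) (σ₁ : Mix A₁) (σ₂ : Mix A₂) : Prop :=
  ∀ τ₂ : Mix A₂, expPay u₂ σ₁ τ₂ ≤ expPay u₂ σ₁ σ₂

/-- Player 2's pure action `a₂` is a best response among pure strategies to mixed `σ₁`. -/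
def BR2pm (u₂ : A₁ → A₂ → ℝ) (σ₁ : Mix A₁) (a₂ : A₂) : Prop :=
  ∀ b₂ : A₂, expPay u₂ σ₁ (Mix.pure b₂) ≤ expPay u₂ σ₁ (Mix.pure a₂)

/-- Pure Nash equilibria (both players restricted to pure strategies). -/
def NashPP (u₁ u₂ : A₁ → A₂ → ℝ) : Set (A₁ × A₂) :=
  {q | BR1p u₁ q.1 q.2 ∧ BR2p u₂ q.1 q.2}

/-- Nash equilibria when player 1 is mixed and player 2 is pure. -/
def NashMP (u₁ u₂ : A₁ → A₂ → ℝ) : Set (Mix A₁ × A₂) :=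
  {q | BR1m u₁ q.1 (Mix.pure q.2) ∧ BR2pm u₂ q.1 q.2}

/-- Mixed Nash equilibria. -/
def NashMM (u₁ u₂ : A₁ → A₂ → ℝ) : Set (Mix A₁ × Mix A₂) :=
  {q | BR1m u₁ q.1 q.2 ∧ BR2m u₂ q.1 q.2}

def V1pp (u₁ u₂ : A₁ → A₂ → ℝ) : Set ℝ := (fun q => u₁ q.1 q.2) '' NashPP u₁ u₂
def V2pp (u₁ u₂ : A₁ → A₂ → ℝ) : Set ℝ := (fun q => u₂ q.1 q.2) '' NashPP u₁ u₂
def V1mp (u₁ u₂ : A₁ → A₂ → ℝ) : Set ℝ :=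
  (fun q => expPay u₁ q.1 (Mix.pure q.2)) '' NashMP u₁ u₂
def V2mp (u₁ u₂ : A₁ → A₂ → ℝ) : Set ℝ :=
  (fun q => expPay u₂ q.1 (Mix.pure q.2)) '' NashMP u₁ u₂
def V1mm (u₁ u₂ : A₁ → A₂ → ℝ) : Set ℝ := (fun q => expPay u₁ q.1 q.2) '' NashMM u₁ u₂
def V2mm (u₁ u₂ : A₁ → A₂ → ℝ) : Set ℝ := (fun q => expPay u₂ q.1 q.2) '' NashMM u₁ u₂

/-- The set `V` is a singleton, i.e. `|V| = 1`. -/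
def oneVal (V : Set ℝ) : Prop := ∃ v, V = {v}

/-- A history of play: a finite sequence of pure action profiles. -/
abbrev Hist (A₁ A₂ : Type*) := List (A₁ × A₂)

/-- A pure behavior strategy for player 1, seen as a mixed behavior strategy. -/
def pureBeh1 (μ : Hist A₁ A₂ → A₁) : Hist A₁ A₂ → Mix A₁ := fun h => Mix.pure (μ h)

/-- A pure behavior strategy for player 2, seen as a mixed behavior strategy. -/
def pureBeh2 (μ : Hist A₁ A₂ → A₂) : Hist A₁ A₂ → Mix A₂ := fun h => Mix.pure (μ h)

/-- Expected total payoff (w.r.t. `u`) over `T` remaining rounds, after history `h`. -/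
def totPay (u : A₁ → A₂ → ℝ) (μ₁ : Hist A₁ A₂ → Mix A₁) (μ₂ : Hist A₁ A₂ → Mix A₂) :
    ℕ → Hist A₁ A₂ → ℝ
  | 0, _ => 0
  | T + 1, h =>
      ∑ a₁, ∑ a₂, (μ₁ h).p a₁ * (μ₂ h).p a₂ * (u a₁ a₂ + totPay u μ₁ μ₂ T (h ++ [(a₁, a₂)]))

/-- The behavior strategy induced on the subgame following history `h`. -/
def condS {A₁ A₂ α : Type*} (μ : Hist A₁ A₂ → α) (h : Hist A₁ A₂) : Hist A₁ A₂ → α :=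
  fun h' => μ (h ++ h')

/-- Nash equilibrium of the `T`-round repeated game, both players mixed. -/
def isNEmm (u₁ u₂ : A₁ → A₂ → ℝ) (T : ℕ)
    (μ₁ : Hist A₁ A₂ → Mix A₁) (μ₂ : Hist A₁ A₂ → Mix A₂) : Prop :=
  (∀ μ₁' : Hist A₁ A₂ → Mix A₁, totPay u₁ μ₁' μ₂ T [] ≤ totPay u₁ μ₁ μ₂ T []) ∧
  (∀ μ₂' : Hist A₁ A₂ → Mix A₂, totPay u₂ μ₁ μ₂' T [] ≤ totPay u₂ μ₁ μ₂ T [])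

/-- Subgame-perfect equilibrium of the `T`-round repeated game, both players mixed. -/
def isSPEmm (u₁ u₂ : A₁ → A₂ → ℝ) (T : ℕ)
    (μ₁ : Hist A₁ A₂ → Mix A₁) (μ₂ : Hist A₁ A₂ → Mix A₂) : Prop :=
  ∀ h : Hist A₁ A₂, h.length < T → isNEmm u₁ u₂ (T - h.length) (condS μ₁ h) (condS μ₂ h)

/-- Nash equilibrium of the `T`-round repeated game, player 1 mixed and player 2 pure. -/
def isNEmp (u₁ u₂ : A₁ → A₂ → ℝ) (T : ℕ)
    (μ₁ : Hist A₁ A₂ → Mix A₁) (μ₂ : Hist A₁ A₂ → A₂) : Prop :=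
  (∀ μ₁' : Hist A₁ A₂ → Mix A₁,
      totPay u₁ μ₁' (pureBeh2 μ₂) T [] ≤ totPay u₁ μ₁ (pureBeh2 μ₂) T []) ∧
  (∀ μ₂' : Hist A₁ A₂ → A₂,
      totPay u₂ μ₁ (pureBeh2 μ₂') T [] ≤ totPay u₂ μ₁ (pureBeh2 μ₂) T [])

/-- SPE of the `T`-round repeated game, player 1 mixed and player 2 pure. -/
def isSPEmp (u₁ u₂ : A₁ → A₂ → ℝ) (T : ℕ)
    (μ₁ : Hist A₁ A₂ → Mix A₁) (μ₂ : Hist A₁ A₂ → A₂) : Prop :=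
  ∀ h : Hist A₁ A₂, h.length < T → isNEmp u₁ u₂ (T - h.length) (condS μ₁ h) (condS μ₂ h)

/-- Nash equilibrium of the `T`-round repeated game, both players pure. -/
def isNEpp (u₁ u₂ : A₁ → A₂ → ℝ) (T : ℕ)
    (μ₁ : Hist A₁ A₂ → A₁) (μ₂ : Hist A₁ A₂ → A₂) : Prop :=
  (∀ μ₁' : Hist A₁ A₂ → A₁,
      totPay u₁ (pureBeh1 μ₁') (pureBeh2 μ₂) T [] ≤
        totPay u₁ (pureBeh1 μ₁) (pureBeh2 μ₂) T []) ∧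
  (∀ μ₂' : Hist A₁ A₂ → A₂,
      totPay u₂ (pureBeh1 μ₁) (pureBeh2 μ₂') T [] ≤
        totPay u₂ (pureBeh1 μ₁) (pureBeh2 μ₂) T [])

/-- SPE of the `T`-round repeated game, both players pure. -/
def isSPEpp (u₁ u₂ : A₁ → A₂ → ℝ) (T : ℕ)
    (μ₁ : Hist A₁ A₂ → A₁) (μ₂ : Hist A₁ A₂ → A₂) : Prop :=
  ∀ h : Hist A₁ A₂, h.length < T → isNEpp u₁ u₂ (T - h.length) (condS μ₁ h) (condS μ₂ h)

/-- `G ∈ 𝒢_LS^{p,p}`: local suboptimality occurs in some SPE of some `G(T)`,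
both players restricted to pure strategies. -/
def GLSpp (u₁ u₂ : A₁ → A₂ → ℝ) : Prop :=
  ∃ T : ℕ, 1 ≤ T ∧ ∃ (μ₁ : Hist A₁ A₂ → A₁) (μ₂ : Hist A₁ A₂ → A₂),
    isSPEpp u₁ u₂ T μ₁ μ₂ ∧ ∃ h : Hist A₁ A₂, h.length < T ∧ (μ₁ h, μ₂ h) ∉ NashPP u₁ u₂

/-- `G ∈ 𝒢_LS^{m,p}`: local suboptimality occurs in some SPE of some `G(T)`,
player 1 mixed and player 2 pure. -/
def GLSmp (u₁ u₂ : A₁ → A₂ → ℝ) : Prop :=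
  ∃ T : ℕ, 1 ≤ T ∧ ∃ (μ₁ : Hist A₁ A₂ → Mix A₁) (μ₂ : Hist A₁ A₂ → A₂),
    isSPEmp u₁ u₂ T μ₁ μ₂ ∧ ∃ h : Hist A₁ A₂, h.length < T ∧ (μ₁ h, μ₂ h) ∉ NashMP u₁ u₂

/-- `G ∈ 𝒢_LS^{m,m}`: local suboptimality occurs in some SPE of some `G(T)`,
both players mixed. -/
def GLSmm (u₁ u₂ : A₁ → A₂ → ℝ) : Prop :=
  ∃ T : ℕ, 1 ≤ T ∧ ∃ (μ₁ : Hist A₁ A₂ → Mix A₁) (μ₂ : Hist A₁ A₂ → Mix A₂),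
    isSPEmm u₁ u₂ T μ₁ μ₂ ∧ ∃ h : Hist A₁ A₂, h.length < T ∧ (μ₁ h, μ₂ h) ∉ NashMM u₁ u₂

/-- The pure-pure characterization condition (condition of the pure-strategy theorem). -/
def condPP (u₁ u₂ : A₁ → A₂ → ℝ) : Prop :=
  ((V1pp u₁ u₂).Nontrivial ∧ (V2pp u₁ u₂).Nontrivial ∧
    ∃ (a₁ : A₁) (a₂ : A₂), (a₁, a₂) ∉ NashPP u₁ u₂) ∨
  ((V1pp u₁ u₂).Nontrivial ∧ oneVal (V2pp u₁ u₂) ∧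
    ∃ (a₁ a₁' : A₁) (a₂ : A₂), u₁ a₁ a₂ < u₁ a₁' a₂ ∧ BR2p u₂ a₁ a₂) ∨
  (oneVal (V1pp u₁ u₂) ∧ (V2pp u₁ u₂).Nontrivial ∧
    ∃ (a₁ : A₁) (a₂ a₂' : A₂), u₂ a₁ a₂ < u₂ a₁ a₂' ∧ BR1p u₁ a₁ a₂)

/-- The mixed-mixed characterization condition (condition of the general-case theorem). -/
def condMM (u₁ u₂ : A₁ → A₂ → ℝ) : Prop :=
  ((V1mm u₁ u₂).Nontrivial ∧ (V2mm u₁ u₂).Nontrivial ∧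
    ∃ (σ₁ : Mix A₁) (σ₂ : Mix A₂), (σ₁, σ₂) ∉ NashMM u₁ u₂) ∨
  ((V1mm u₁ u₂).Nontrivial ∧ oneVal (V2mm u₁ u₂) ∧
    ∃ (σ₁ : Mix A₁) (σ₂ : Mix A₂) (a₁' : A₁),
      expPay u₁ σ₁ σ₂ < expPay u₁ (Mix.pure a₁') σ₂ ∧ BR2m u₂ σ₁ σ₂) ∨
  (oneVal (V1mm u₁ u₂) ∧ (V2mm u₁ u₂).Nontrivial ∧
    ∃ (σ₁ : Mix A₁) (σ₂ : Mix A₂) (a₂' : A₂),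
      expPay u₂ σ₁ σ₂ < expPay u₂ σ₁ (Mix.pure a₂') ∧ BR1m u₁ σ₁ σ₂)

/-- The set `D` of differences of player 1's payoffs between pairs of stage-game
Nash equilibria (mixed-pure case). -/
def Dmp (u₁ u₂ : A₁ → A₂ → ℝ) : Set ℝ :=
  {x | ∃ q ∈ NashMP u₁ u₂, ∃ q' ∈ NashMP u₁ u₂,
    x = expPay u₁ q.1 (Mix.pure q.2) - expPay u₁ q'.1 (Mix.pure q'.2)}

/-- `x` is a finite (possibly empty) sum of elements of `D`. -/
def sumOfD (D : Set ℝ) (x : ℝ) : Prop :=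
  ∃ (n : ℕ) (d : Fin n → ℝ), (∀ k, d k ∈ D) ∧ x = ∑ k, d k

/-- The mixed-pure characterization condition (condition of the
pure-strategy-against-mixed-strategy theorem). -/
def condMP (u₁ u₂ : A₁ → A₂ → ℝ) : Prop :=
  ((V1mp u₁ u₂).Nontrivial ∧ (V2mp u₁ u₂).Nontrivial ∧
    ∃ (σ₁ : Mix A₁) (a₂ : A₂), (σ₁, a₂) ∉ NashMP u₁ u₂) ∨
  ((V1mp u₁ u₂).Nontrivial ∧ oneVal (V2mp u₁ u₂) ∧
    ∃ (σ₁ : Mix A₁) (a₁' : A₁) (a₂ : A₂),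
      expPay u₁ σ₁ (Mix.pure a₂) < u₁ a₁' a₂ ∧
      BR2pm u₂ σ₁ a₂ ∧
      (σ₁.support.Nontrivial →
        ∃ a ∈ σ₁.support, ∀ a' ∈ σ₁.support, a' ≠ a →
          sumOfD (Dmp u₁ u₂) (u₁ a a₂ - u₁ a' a₂))) ∨
  (oneVal (V1mp u₁ u₂) ∧ (V2mp u₁ u₂).Nontrivial ∧
    ∃ (σ₁ : Mix A₁) (a₂ a₂' : A₂),
      expPay u₂ σ₁ (Mix.pure a₂) < expPay u₂ σ₁ (Mix.pure a₂') ∧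
      BR1m u₁ σ₁ (Mix.pure a₂))

/-- A history is reachable under the behavior profile `(μ₁, μ₂)` (mixed-pure case):
every action of player 1 along it has positive probability and every action of
player 2 along it is the prescribed one. -/
def reachableMP (μ₁ : Hist A₁ A₂ → Mix A₁) (μ₂ : Hist A₁ A₂ → A₂) (h : Hist A₁ A₂) : Prop :=
  ∀ k : Fin h.length, 0 < (μ₁ (h.take k.val)).p (h.get k).1 ∧ μ₂ (h.take k.val) = (h.get k).2

end TwoPlayer

section Payoffs

variable {A₁ A₂ : Type*} [Fintype A₁] [Fintype A₂]

lemma expPay_mono {u v : A₁ → A₂ → ℝ} (huv : ∀ a b, u a b ≤ v a b) (σ : Mix A₁) (τ : Mix A₂) :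
    expPay u σ τ ≤ expPay v σ τ :=
  Finset.sum_le_sum fun a _ => Finset.sum_le_sum fun b _ =>
    mul_le_mul_of_nonneg_left (huv a b) (mul_nonneg (σ.nonneg a) (τ.nonneg b))

lemma expPay_add_const (u : A₁ → A₂ → ℝ) (c : ℝ) (σ : Mix A₁) (τ : Mix A₂) :
    expPay (fun a b => u a b + c) σ τ = expPay u σ τ + c := by
  simp only [expPay, mul_add, Finset.sum_add_distrib, ← Finset.sum_mul, ← Finset.mul_sum,
    σ.sum_one, τ.sum_one, mul_one, one_mul]

lemma totPay_succ (u : A₁ → A₂ → ℝ) (μ₁ : Hist A₁ A₂ → Mix A₁) (μ₂ : Hist A₁ A₂ → Mix A₂)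
    (k : ℕ) (h : Hist A₁ A₂) :
    totPay u μ₁ μ₂ (k + 1) h =
      expPay (fun a b => u a b + totPay u μ₁ μ₂ k (h ++ [(a, b)])) (μ₁ h) (μ₂ h) := rfl

/-- A bound on the stage payoffs after `h` bounds the total payoff after `h`. -/
lemma totPay_le {u : A₁ → A₂ → ℝ} {μ₁ : Hist A₁ A₂ → Mix A₁} {μ₂ : Hist A₁ A₂ → Mix A₂}
    {v : ℝ} (k : ℕ) (h : Hist A₁ A₂)
    (H : ∀ h', expPay u (μ₁ (h ++ h')) (μ₂ (h ++ h')) ≤ v) :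
    totPay u μ₁ μ₂ k h ≤ k * v := by
  induction k generalizing h with
  | zero => simp [totPay]
  | succ k ih =>
    have h1 := expPay_mono (fun a b => add_le_add_right
      (ih (h ++ [(a, b)]) fun h' => by simpa using H ((a, b) :: h')) (u a b)) (μ₁ h) (μ₂ h)
    rw [expPay_add_const] at h1
    have h2 := H []
    rw [List.append_nil] at h2
    rw [totPay_succ]
    push_cast
    linarith

lemma le_totPay {u : A₁ → A₂ → ℝ} {μ₁ : Hist A₁ A₂ → Mix A₁} {μ₂ : Hist A₁ A₂ → Mix A₂}
    {v : ℝ} (k : ℕ) (h : Hist A₁ A₂)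
    (H : ∀ h', v ≤ expPay u (μ₁ (h ++ h')) (μ₂ (h ++ h'))) :
    k * v ≤ totPay u μ₁ μ₂ k h := by
  induction k generalizing h with
  | zero => simp [totPay]
  | succ k ih =>
    have h1 := expPay_mono (fun a b => add_le_add_right
      (ih (h ++ [(a, b)]) fun h' => by simpa using H ((a, b) :: h')) (u a b)) (μ₁ h) (μ₂ h)
    rw [expPay_add_const] at h1
    have h2 := H []
    rw [List.append_nil] at h2
    rw [totPay_succ]
    push_cast
    linarith

lemma totPay_condS (u : A₁ → A₂ → ℝ) (μ₁ : Hist A₁ A₂ → Mix A₁) (μ₂ : Hist A₁ A₂ → Mix A₂)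
    (h : Hist A₁ A₂) (k : ℕ) (h' : Hist A₁ A₂) :
    totPay u (condS μ₁ h) (condS μ₂ h) k h' = totPay u μ₁ μ₂ k (h ++ h') := by
  induction k generalizing h' with
  | zero => rfl
  | succ k ih => simp only [totPay_succ, ih, List.append_assoc, condS]

variable [DecidableEq A₂]

lemma expPay_pure_right (u : A₁ → A₂ → ℝ) (σ : Mix A₁) (b : A₂) :
    expPay u σ (Mix.pure b) = ∑ a, σ.p a * u a b := by
  simp [expPay, Mix.pure]

lemma expPay_pure_right_le {u : A₁ → A₂ → ℝ} {b : A₂} {v : ℝ} (H : ∀ a, u a b ≤ v)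
    (σ : Mix A₁) : expPay u σ (Mix.pure b) ≤ v := by
  rw [expPay_pure_right, ← one_mul v, ← σ.sum_one, Finset.sum_mul]
  exact Finset.sum_le_sum fun a _ => mul_le_mul_of_nonneg_left (H a) (σ.nonneg a)

lemma eq_of_expPay_pure_right_eq {u : A₁ → A₂ → ℝ} {b : A₂} {v : ℝ} (H : ∀ a, u a b ≤ v)
    {σ : Mix A₁} (hσ : expPay u σ (Mix.pure b) = v) {a : A₁} (ha : σ.p a ≠ 0) : u a b = v := by
  have hsum : ∑ a, σ.p a * (v - u a b) = 0 := by
    simp only [mul_sub, Finset.sum_sub_distrib, ← Finset.sum_mul, σ.sum_one, one_mul]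
    rw [← expPay_pure_right, hσ, sub_self]
  have h0 := (Finset.sum_eq_zero_iff_of_nonneg fun a _ =>
    mul_nonneg (σ.nonneg a) (sub_nonneg.2 (H a))).1 hsum a (Finset.mem_univ a)
  linarith [(mul_eq_zero.1 h0).resolve_left ha]

variable [DecidableEq A₁]

@[simp]
lemma expPay_pure_pure (u : A₁ → A₂ → ℝ) (a : A₁) (b : A₂) :
    expPay u (Mix.pure a) (Mix.pure b) = u a b := by
  rw [expPay_pure_right]
  simp [Mix.pure]

lemma totPay_pure_succ (u : A₁ → A₂ → ℝ) (μ₁ : Hist A₁ A₂ → A₁) (μ₂ : Hist A₁ A₂ → A₂)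
    (k : ℕ) (h : Hist A₁ A₂) :
    totPay u (pureBeh1 μ₁) (pureBeh2 μ₂) (k + 1) h =
      u (μ₁ h) (μ₂ h) + totPay u (pureBeh1 μ₁) (pureBeh2 μ₂) k (h ++ [(μ₁ h, μ₂ h)]) := by
  rw [totPay_succ]
  exact expPay_pure_pure _ _ _

lemma totPay_pure_le {u : A₁ → A₂ → ℝ} {μ₁ : Hist A₁ A₂ → A₁} {μ₂ : Hist A₁ A₂ → A₂} {v : ℝ}
    (k : ℕ) (h : Hist A₁ A₂) (H : ∀ h', u (μ₁ (h ++ h')) (μ₂ (h ++ h')) ≤ v) :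
    totPay u (pureBeh1 μ₁) (pureBeh2 μ₂) k h ≤ k * v :=
  totPay_le k h fun h' => by simpa [pureBeh1, pureBeh2] using H h'

lemma totPay_pure_eq {u : A₁ → A₂ → ℝ} {μ₁ : Hist A₁ A₂ → A₁} {μ₂ : Hist A₁ A₂ → A₂} {v : ℝ}
    (k : ℕ) (h : Hist A₁ A₂) (H : ∀ h', u (μ₁ (h ++ h')) (μ₂ (h ++ h')) = v) :
    totPay u (pureBeh1 μ₁) (pureBeh2 μ₂) k h = k * v :=
  le_antisymm (totPay_pure_le k h fun h' => (H h').le)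
    (le_totPay k h fun h' => by simpa [pureBeh1, pureBeh2] using (H h').ge)

/-- Repeating a stage Nash equilibrium is a Nash equilibrium of the repeated game. -/
lemma isNEpp_const {u₁ u₂ : A₁ → A₂ → ℝ} {q : A₁ × A₂} (hq : q ∈ NashPP u₁ u₂) (T : ℕ) :
    isNEpp u₁ u₂ T (fun _ => q.1) (fun _ => q.2) :=
  ⟨fun _ => (totPay_pure_le T [] fun _ => hq.1 _).trans
      (totPay_pure_eq T [] fun _ => rfl).ge,
    fun _ => (totPay_pure_le T [] fun _ => hq.2 _).trans
      (totPay_pure_eq T [] fun _ => rfl).ge⟩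

/-- If player 1 is indifferent between two stage equilibria that player 2 ranks strictly, then
player 2 can be induced to play suboptimally against any best-responding action of player 1:
the better equilibrium rewards compliance in the first round, the worse one punishes deviation. -/
lemma GLSpp_of_reward {u₁ u₂ : A₁ → A₂ → ℝ} {g b : A₁ × A₂} (hg : g ∈ NashPP u₁ u₂)
    (hb : b ∈ NashPP u₁ u₂) (h1 : u₁ g.1 g.2 = u₁ b.1 b.2) (h2 : u₂ b.1 b.2 < u₂ g.1 g.2)
    {a₁ : A₁} {a₂ : A₂} (hBR1 : BR1p u₁ a₁ a₂) (hBR2 : ¬ BR2p u₂ a₁ a₂) : GLSpp u₁ u₂ := by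
  obtain ⟨M, hM⟩ := (Set.finite_range fun c => u₂ a₁ c - u₂ a₁ a₂).bddAbove
  obtain ⟨N, hN⟩ := Archimedean.arch M (sub_pos.2 h2)
  rw [nsmul_eq_mul] at hN
  obtain ⟨q, hqg, hqb⟩ : ∃ q : A₁ × A₂ → A₁ × A₂,
      (∀ c, c.2 = a₂ → q c = g) ∧ ∀ c, c.2 ≠ a₂ → q c = b :=
    ⟨fun c => if c.2 = a₂ then g else b, fun _ hc => if_pos hc, fun _ hc => if_neg hc⟩
  have hq : ∀ c, q c ∈ NashPP u₁ u₂ ∧ u₁ (q c).1 (q c).2 = u₁ b.1 b.2 := fun c => by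
    by_cases hc : c.2 = a₂
    · rw [hqg c hc]
      exact ⟨hg, h1⟩
    · rw [hqb c hc]
      exact ⟨hb, rfl⟩
  let μ : Hist A₁ A₂ → A₁ × A₂ := fun h => h.head?.elim (a₁, a₂) q
  refine ⟨N + 1, by omega, fun h => (μ h).1, fun h => (μ h).2, ?_, [], by simp,
    fun hn => hBR2 hn.2⟩
  rintro (_ | ⟨c, h⟩) -
  swap
  · exact isNEpp_const (hq c).1 _
  refine ⟨fun μ' => ?_, fun μ' => ?_⟩
  · change totPay u₁ (pureBeh1 μ') (pureBeh2 fun h => (μ h).2) (N + 1) [] ≤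
      totPay u₁ (pureBeh1 fun h => (μ h).1) (pureBeh2 fun h => (μ h).2) (N + 1) []
    rw [totPay_pure_succ, totPay_pure_succ]
    refine add_le_add (hBR1 _) ((totPay_pure_le (v := u₁ b.1 b.2) N _ fun h' => ?_).trans
      (totPay_pure_eq N _ fun h' => ?_).ge)
    · exact ((hq _).1.1 _).trans (hq _).2.le
    · exact (hq _).2
  · change totPay u₂ (pureBeh1 fun h => (μ h).1) (pureBeh2 μ') (N + 1) [] ≤
      totPay u₂ (pureBeh1 fun h => (μ h).1) (pureBeh2 fun h => (μ h).2) (N + 1) []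
    rw [totPay_pure_succ, totPay_pure_succ,
      totPay_pure_eq (μ₁ := fun h => (μ h).1) (μ₂ := fun h => (μ h).2) (v := u₂ g.1 g.2) N _
        fun h' => by simp [μ, hqg]]
    have hdev := totPay_pure_le (u := u₂) (μ₁ := fun h => (μ h).1) (μ₂ := μ')
      (v := u₂ (q (a₁, μ' [])).1 (q (a₁, μ' [])).2) N
      [(a₁, μ' [])] fun h' => (hq (a₁, μ' [])).1.2 (μ' ((a₁, μ' []) :: h'))
    refine (add_le_add_right hdev _).trans ?_
    by_cases hc : μ' [] = a₂
    · simp [μ, hqg, hc]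
    · have hgain := hM ⟨μ' [], rfl⟩
      rw [hqb _ hc]
      simp only [μ, List.head?_nil, Option.elim_none] at hgain ⊢
      linarith

/-- If player 1 can secure exactly `v` against every action of player 2, and every best response of
player 1 is a stage equilibrium, then every round of a mixed-pure equilibrium is a stage
equilibrium. -/
lemma not_GLSmp_of_forall_max_eq {u₁ u₂ : A₁ → A₂ → ℝ} {v : ℝ} (hle : ∀ a b, u₁ a b ≤ v)
    (hmax : ∀ b, ∃ a, u₁ a b = v) (hBR : ∀ a b, u₁ a b = v → BR2p u₂ a b) :
    ¬ GLSmp u₁ u₂ := by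
  choose β hβ using hmax
  rintro ⟨T, -, μ₁, μ₂, hSPE, h, hT, hn⟩
  have hval : ∀ (k : ℕ) (h : Hist A₁ A₂), h.length + k = T →
      totPay u₁ μ₁ (pureBeh2 μ₂) k h = k * v := by
    rintro k h rfl
    rcases Nat.eq_zero_or_pos k with rfl | hk
    · simp [totPay]
    refine le_antisymm (totPay_le k h fun h' => expPay_pure_right_le (hle · _) _) ?_
    have hNE := (hSPE h (by omega)).1 (pureBeh1 fun h' => β (condS μ₂ h h'))
    rw [Nat.add_sub_cancel_left, totPay_pure_eq (v := v) k [] fun h' => hβ _] at hNE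
    refine hNE.trans_eq ?_
    exact (totPay_condS u₁ μ₁ (pureBeh2 μ₂) h k []).trans (by rw [List.append_nil])
  obtain ⟨k, rfl⟩ : ∃ k, T = h.length + (k + 1) := ⟨T - h.length - 1, by omega⟩
  have hstage : expPay u₁ (μ₁ h) (Mix.pure (μ₂ h)) = v := by
    have htot := hval (k + 1) h rfl
    have hcont : ∀ a b, totPay u₁ μ₁ (pureBeh2 μ₂) k (h ++ [(a, b)]) = k * v :=
      fun a b => hval k _ (by simp; omega)
    simp only [totPay_succ, hcont, expPay_add_const] at htot
    push_cast at htot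
    change expPay u₁ (μ₁ h) (Mix.pure (μ₂ h)) + _ = _ at htot
    linarith
  refine hn ⟨fun τ => (expPay_pure_right_le (hle · _) τ).trans hstage.ge, fun b => ?_⟩
  simp only [expPay_pure_right u₂]
  refine Finset.sum_le_sum fun a _ => ?_
  by_cases ha : (μ₁ h).p a = 0
  · simp [ha]
  · exact mul_le_mul_of_nonneg_left
      (hBR a _ (eq_of_expPay_pure_right_eq (hle · _) hstage ha) b) ((μ₁ h).nonneg a)

end Payoffs

section TwoPlayer
variable {A₁ A₂ : Type*} [Fintype A₁] [Fintype A₂] [DecidableEq A₁] [DecidableEq A₂]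
variable [Nonempty A₁] [Nonempty A₂]

/-- If `|V₁^{p,p}| = 1`, `|V₂^{p,p}| > 1`, and `G ∉ 𝒢_LS^{p,p}`, then `G ∉ 𝒢_LS^{m,p}`. -/
theorem not_GLSmp_of_not_GLSpp (u₁ u₂ : A₁ → A₂ → ℝ)
    (hV1 : oneVal (V1pp u₁ u₂)) (hV2 : (V2pp u₁ u₂).Nontrivial)
    (h : ¬ GLSpp u₁ u₂) : ¬ GLSmp u₁ u₂ := by
  obtain ⟨v, hv⟩ := hV1
  have hNash : ∀ q ∈ NashPP u₁ u₂, u₁ q.1 q.2 = v := fun q hq => by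
    have : u₁ q.1 q.2 ∈ V1pp u₁ u₂ := ⟨q, hq, rfl⟩
    rwa [hv] at this
  obtain ⟨_, ⟨b, hb, rfl⟩, _, ⟨g, hg, rfl⟩, hlt⟩ := hV2.exists_lt
  have hBR : ∀ a₁ a₂, BR1p u₁ a₁ a₂ → BR2p u₂ a₁ a₂ := fun a₁ a₂ h1 => by
    by_contra h2
    exact h (GLSpp_of_reward hg hb ((hNash g hg).trans (hNash b hb).symm) hlt h1 h2)
  have hmax : ∀ a₂, ∃ a₁, BR1p u₁ a₁ a₂ := fun a₂ => Finite.exists_max (u₁ · a₂)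
  have hval : ∀ a₁ a₂, BR1p u₁ a₁ a₂ → u₁ a₁ a₂ = v :=
    fun a₁ a₂ h1 => hNash (a₁, a₂) ⟨h1, hBR a₁ a₂ h1⟩
  have hle : ∀ a₁ a₂, u₁ a₁ a₂ ≤ v := fun a₁ a₂ => by
    obtain ⟨c, hc⟩ := hmax a₂
    exact (hc a₁).trans (hval c a₂ hc).le
  exact not_GLSmp_of_forall_max_eq hle (fun a₂ => (hmax a₂).imp fun a₁ => hval a₁ a₂)
    fun a₁ a₂ he => hBR a₁ a₂ fun c => (hle c a₂).trans he.ge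

end TwoPlayer
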